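/- arXiv:2510.01333 — 2 statements merged into one kernel-verified Lean document; each statement's English description precedes it below -/
import Mathlib

section
/- Let H = E_{i∈[m]} Π_i be an average of m commuting projections on a finite-dimensional Hilbert space, and fix registers i ≠ j and a state σ on the tensor product of copies of this space. Suppose the pair (u,v) ∈ [m]² is sampled such that each marginal is uniform and the joint distribution is given by Pr[(u,v)] = (1/m)·(Pᵗ)_{u,v} where P is the transition matrix of a d-regular μ·d-spectral expander on [m] and t = |j−i|. Then E_{(u,v)} Tr[(Π_v)_{reg i} (Π_u)_{reg j} σ] ≤ Tr[H_{reg i} ⊗ H_{reg j} σ] + μᵗ·(Tr[H_{reg i} σ] + Tr[H_{reg j} σ]). -/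
open Finset Matrix
open scoped ComplexOrder

/-- The tensor product of a finite family of square matrices, realised as a
matrix indexed by tuples: `(⊗_j M j) (x, y) = ∏ j, M j (x j) (y j)`. -/
def tensorFam {ι V : Type*} [Fintype ι] (M : ι → Matrix V V ℂ) :
    Matrix (ι → V) (ι → V) ℂ :=
  Matrix.of fun x y => ∏ j, M j (x j) (y j)

/-- The operator `A` acting on register `i` of a tensor product of identical
registers, and identity elsewhere. -/
def regOp {ι V : Type*} [Fintype ι] [DecidableEq ι] [Fintype V] [DecidableEq V]
    (i : ι) (A : Matrix V V ℂ) : Matrix (ι → V) (ι → V) ℂ :=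
  tensorFam (fun j => if j = i then A else 1)

theorem tensorFam_mul' {ι V : Type*} [Fintype ι] [DecidableEq ι] [Fintype V]
    (M N : ι → Matrix V V ℂ) :
    tensorFam M * tensorFam N = tensorFam (fun j => M j * N j) := by
  ext x y
  simp only [tensorFam, Matrix.mul_apply, Matrix.of_apply]
  rw [Finset.prod_univ_sum]
  simp [Finset.prod_mul_distrib]

theorem regOp_mul' {ι V : Type*} [Fintype ι] [DecidableEq ι] [Fintype V] [DecidableEq V]
    (i : ι) (A B : Matrix V V ℂ) : regOp i A * regOp i B = regOp i (A * B) := by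
  unfold regOp
  rw [tensorFam_mul']
  congr 1
  funext k
  split_ifs <;> simp

theorem regOp_herm' {ι V : Type*} [Fintype ι] [DecidableEq ι] [Fintype V] [DecidableEq V]
    (i : ι) (A : Matrix V V ℂ) (hA : A.IsHermitian) : (regOp i A)ᴴ = regOp i A := by
  ext x y
  simp only [regOp, tensorFam, Matrix.conjTranspose_apply, Matrix.of_apply, star_prod]
  refine Finset.prod_congr rfl fun k _ => ?_
  split_ifs
  · exact hA.apply _ _
  · exact Matrix.isHermitian_one.apply _ _

theorem regOp_apply' {ι V : Type*} [Fintype ι] [DecidableEq ι] [Fintype V] [DecidableEq V]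
    (i : ι) (A : Matrix V V ℂ) (x y : ι → V) :
    regOp i A x y = A (x i) (y i) * ∏ k ∈ univ.erase i, (1 : Matrix V V ℂ) (x k) (y k) := by
  simp only [regOp, tensorFam, Matrix.of_apply]
  rw [← Finset.mul_prod_erase univ _ (Finset.mem_univ i)]
  simp only [if_true]
  congr 1
  refine Finset.prod_congr rfl fun k hk => ?_
  rw [if_neg (Finset.ne_of_mem_erase hk)]

theorem regOp_avg' {ι V : Type*} [Fintype ι] [DecidableEq ι] [Fintype V] [DecidableEq V]
    {m : ℕ} (i : ι) (c : ℂ) (A : Fin m → Matrix V V ℂ) :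
    regOp i (c • ∑ u, A u) = c • ∑ u, regOp i (A u) := by
  ext x y
  simp only [Matrix.smul_apply, Matrix.sum_apply, regOp_apply', smul_eq_mul, Finset.sum_mul,
    Finset.mul_sum, mul_assoc]

theorem walk_real {m : ℕ} (hm : 0 < m) (μ : ℝ) (hμ : 0 ≤ μ)
    (P : Matrix (Fin m) (Fin m) ℝ) (hsymm : P.IsSymm)
    (hstoch : ∀ u, ∑ v, P u v = 1)
    (hgap : ∀ w : Fin m → ℝ, (∑ u, w u) = 0 →
      ∑ u, (P.mulVec w u) ^ 2 ≤ μ ^ 2 * ∑ u, w u ^ 2)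
    (t : ℕ) (f g : Fin m → ℝ) :
    ∑ u, ∑ v, (P ^ t) u v * (f v * g u) ≤
      (m : ℝ)⁻¹ * ∑ u, ∑ v, f v * g u + μ ^ t * (∑ v, f v ^ 2 + ∑ u, g u ^ 2) := by
  have hm' : (m : ℝ) ≠ 0 := by positivity
  have h1 : ∀ t : ℕ, (P ^ t).mulVec (fun _ => (1 : ℝ)) = fun _ => 1 := by
    intro t
    induction t with
    | zero => simp
    | succ k ih =>
      rw [pow_succ, ← Matrix.mulVec_mulVec]
      have : P.mulVec (fun _ => (1 : ℝ)) = fun _ => 1 := by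
        funext u
        simp [Matrix.mulVec, dotProduct, hstoch]
      rw [this, ih]
  have hcol : ∀ v, ∑ u, P u v = 1 := by
    intro v
    rw [← hstoch v]
    exact Finset.sum_congr rfl fun u _ => hsymm.apply v u
  have h2 : ∀ (t : ℕ) (w : Fin m → ℝ), ∑ u, w u = 0 →
      ∑ u, ((P ^ t).mulVec w u) ^ 2 ≤ (μ ^ t) ^ 2 * ∑ u, w u ^ 2 := by
    intro t
    induction t with
    | zero => intro w _; simp
    | succ k ih =>
      intro w hw
      rw [pow_succ, ← Matrix.mulVec_mulVec]
      have h0 : ∑ u, P.mulVec w u = 0 := by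
        simp only [Matrix.mulVec, dotProduct]
        rw [Finset.sum_comm]
        simp only [← Finset.sum_mul, hcol, one_mul, hw]
      calc _ ≤ (μ ^ k) ^ 2 * ∑ u, (P.mulVec w u) ^ 2 := ih _ h0
        _ ≤ (μ ^ k) ^ 2 * (μ ^ 2 * ∑ u, w u ^ 2) := by
            gcongr
            exact hgap w hw
        _ = _ := by ring
  set a : ℝ := (m : ℝ)⁻¹ * ∑ v, f v with ha
  set w : Fin m → ℝ := fun v => f v - a with hw
  have hsum : ∑ v, f v = m * a := by rw [ha]; field_simp
  have hw0 : ∑ u, w u = 0 := by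
    simp [hw, Finset.sum_sub_distrib, hsum]
  have hwsq : ∑ u, w u ^ 2 ≤ ∑ v, f v ^ 2 := by
    have : ∑ u, w u ^ 2 = ∑ v, f v ^ 2 - m * a ^ 2 := by
      have e : ∀ u, w u ^ 2 = f u ^ 2 - 2 * a * f u + a ^ 2 := fun u => by simp only [hw]; ring
      simp only [e, Finset.sum_add_distrib, Finset.sum_sub_distrib, ← Finset.mul_sum, hsum]
      simp
      ring
    rw [this]
    have : 0 ≤ (m : ℝ) * a ^ 2 := by positivity
    linarith
  set h := (P ^ t).mulVec w with hh
  have hf : ∀ u, ∑ v, (P ^ t) u v * f v = a + h u := by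
    intro u
    have := congrFun (h1 t) u
    simp only [Matrix.mulVec, dotProduct, mul_one] at this
    simp only [hh, hw, Matrix.mulVec, dotProduct, mul_sub, Finset.sum_sub_distrib,
      ← Finset.sum_mul, this]
    ring
  have hL : ∑ u, ∑ v, (P ^ t) u v * (f v * g u) = a * ∑ u, g u + ∑ u, h u * g u := by
    simp only [← mul_assoc, ← Finset.sum_mul, hf]
    simp only [add_mul, Finset.sum_add_distrib, Finset.mul_sum]
  have hR : (m : ℝ)⁻¹ * ∑ u, ∑ v, f v * g u = a * ∑ u, g u := by
    simp only [← Finset.sum_mul, ← Finset.mul_sum, ha]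
    ring
  rw [hL, hR]
  have hcs := Finset.sum_mul_sq_le_sq_mul_sq univ h g
  have hF : 0 ≤ ∑ v, f v ^ 2 := by positivity
  have hG : 0 ≤ ∑ v, g v ^ 2 := by positivity
  have hhF : ∑ u, h u ^ 2 ≤ (μ ^ t) ^ 2 * ∑ v, f v ^ 2 :=
    (h2 t w hw0).trans (by gcongr)
  have key : ∑ u, h u * g u ≤ μ ^ t * (∑ v, f v ^ 2 + ∑ u, g u ^ 2) := by
    refine abs_le_of_sq_le_sq' ?_ (by positivity) |>.2
    calc _ ≤ (∑ u, h u ^ 2) * ∑ u, g u ^ 2 := hcs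
      _ ≤ ((μ ^ t) ^ 2 * ∑ v, f v ^ 2) * ∑ u, g u ^ 2 := by gcongr
      _ = (μ ^ t) ^ 2 * ((∑ v, f v ^ 2) * ∑ u, g u ^ 2) := by ring
      _ ≤ (μ ^ t) ^ 2 * (∑ v, f v ^ 2 + ∑ u, g u ^ 2) ^ 2 := by
          gcongr
          nlinarith [mul_nonneg hF hG]
      _ = _ := by ring
  linarith

theorem trace_inner' {W : Type*} [Fintype W] (A B T : Matrix W W ℂ) (hA : Aᴴ = A) :
    ((A * B * (T * Tᴴ)).trace).re = ∑ p : W × W,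
      (((A * T) p.1 p.2).re * ((B * T) p.1 p.2).re
        + ((A * T) p.1 p.2).im * ((B * T) p.1 p.2).im) := by
  have : (A * B * (T * Tᴴ)).trace = ((A * T)ᴴ * (B * T)).trace := by
    rw [← Matrix.mul_assoc, Matrix.trace_mul_comm, Matrix.conjTranspose_mul, hA]
    simp only [Matrix.mul_assoc]
  rw [this, Fintype.sum_prod_type_right]
  generalize A * T = M
  generalize B * T = N
  simp [Matrix.trace, Matrix.mul_apply]

theorem walk_vec {m : ℕ} (hm : 0 < m) (μ : ℝ) (hμ : 0 ≤ μ)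
    (P : Matrix (Fin m) (Fin m) ℝ) (hsymm : P.IsSymm)
    (hstoch : ∀ u, ∑ v, P u v = 1)
    (hgap : ∀ w : Fin m → ℝ, (∑ u, w u) = 0 →
      ∑ u, (P.mulVec w u) ^ 2 ≤ μ ^ 2 * ∑ u, w u ^ 2)
    (t : ℕ) {Q : Type*} [Fintype Q] (x y : Fin m → Q → ℂ) :
    ∑ u, ∑ v, (m : ℝ)⁻¹ * (P ^ t) u v *
        ∑ q, ((x v q).re * (y u q).re + (x v q).im * (y u q).im) ≤
      (m : ℝ)⁻¹ * ((m : ℝ)⁻¹ * ∑ u, ∑ v,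
        ∑ q, ((x v q).re * (y u q).re + (x v q).im * (y u q).im)) +
      μ ^ t * ((m : ℝ)⁻¹ * ∑ v, ∑ q, ((x v q).re * (x v q).re + (x v q).im * (x v q).im)
        + (m : ℝ)⁻¹ * ∑ v, ∑ q, ((y v q).re * (y v q).re + (y v q).im * (y v q).im)) := by
  have hw := fun f g => walk_real hm μ hμ P hsymm hstoch hgap t f g
  have sw : ∀ F : Fin m → Fin m → Q → ℝ,
      ∑ u, ∑ v, ∑ q, F u v q = ∑ q, ∑ u, ∑ v, F u v q := by
    intro F
    rw [Finset.sum_comm (s := (univ : Finset Q))]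
    refine Finset.sum_congr rfl fun u _ => ?_
    rw [Finset.sum_comm]
  have sw1 : ∀ F : Fin m → Q → ℝ, ∑ v, ∑ q, F v q = ∑ q, ∑ v, F v q := 
    fun F => Finset.sum_comm
  simp only [Finset.mul_sum (s := (univ : Finset Q))]
  rw [sw, sw, sw1, sw1]
  simp only [Finset.mul_sum (s := (univ : Finset Q)), ← Finset.sum_add_distrib]
  refine Finset.sum_le_sum fun q _ => ?_
  have h3 := mul_le_mul_of_nonneg_left (add_le_add
    (hw (fun v => (x v q).re) (fun v => (y v q).re))
    (hw (fun v => (x v q).im) (fun v => (y v q).im)))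
    (show (0 : ℝ) ≤ (m : ℝ)⁻¹ by positivity)
  refine (le_of_eq ?_).trans (h3.trans (le_of_eq ?_))
  · simp only [Finset.mul_sum, ← Finset.sum_add_distrib]
    refine Finset.sum_congr rfl fun u _ => Finset.sum_congr rfl fun v _ => ?_
    ring
  · simp only [Finset.sum_add_distrib, pow_two]
    ring

/-- Expander-walk decorrelation for a commuting layer: if the pair `(u,v)` is
sampled with joint law `Pr[(u,v)] = (1/m)(Pᵗ)_{u,v}` from a `μ`-spectral
expander random walk, then the correlated energy
`E_{(u,v)} Tr[(Π_v)_{reg i}(Π_u)_{reg j} σ]` exceeds the decoupled one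
`Tr[H_{reg i} H_{reg j} σ]` by at most `μᵗ(Tr[H_{reg i}σ] + Tr[H_{reg j}σ])`. -/
theorem expander_walk_decorrelation
    {m : ℕ} (hm : 0 < m) {V ι : Type*} [Fintype V] [DecidableEq V]
    [Fintype ι] [DecidableEq ι]
    (Proj : Fin m → Matrix V V ℂ)
    (hherm : ∀ u, (Proj u).IsHermitian) (hidem : ∀ u, Proj u * Proj u = Proj u)
    (hcomm : ∀ u v, Proj u * Proj v = Proj v * Proj u)
    (H : Matrix V V ℂ) (hH : H = ((m : ℂ))⁻¹ • ∑ u, Proj u)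
    (μ : ℝ) (hμ : 0 ≤ μ) (d : ℕ) (hd : 0 < d)
    (P : Matrix (Fin m) (Fin m) ℝ) (hsymm : P.IsSymm)
    (hPnn : ∀ u v, 0 ≤ P u v) (hPd : ∀ u v, ∃ c : ℕ, c ≤ d ∧ P u v = (c : ℝ) / d)
    (hstoch : ∀ u, ∑ v, P u v = 1)
    (hgap : ∀ w : Fin m → ℝ, (∑ u, w u) = 0 →
      ∑ u, (P.mulVec w u) ^ 2 ≤ μ ^ 2 * ∑ u, w u ^ 2)
    (t : ℕ)
    (σ : Matrix (ι → V) (ι → V) ℂ) (hσ : σ.PosSemidef) (hσtr : σ.trace = 1)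
    (i j : ι) (hij : i ≠ j) :
    ∑ u, ∑ v, ((m : ℝ))⁻¹ * (P ^ t) u v *
        ((regOp i (Proj v) * regOp j (Proj u) * σ).trace).re
      ≤ ((regOp i H * regOp j H * σ).trace).re +
        μ ^ t * (((regOp i H * σ).trace).re + ((regOp j H * σ).trace).re) := by
  obtain ⟨S, hS⟩ : ∃ S : Matrix (ι → V) (ι → V) ℂ, σ = S * Sᴴ := by
    obtain ⟨B, hB⟩ := (by open scoped MatrixOrder in exact CStarAlgebra.nonneg_iff_eq_star_mul_self.mp hσ.nonneg : ∃ B : Matrix (ι → V) (ι → V) ℂ, σ = Bᴴ * B)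
    exact ⟨Bᴴ, by rw [Matrix.conjTranspose_conjTranspose]; exact hB⟩
  have hm' : (m : ℝ) ≠ 0 := by positivity
  have hre : ∀ z : ℂ, ((m : ℂ)⁻¹ * z).re = (m : ℝ)⁻¹ * z.re := by
    intro z
    rw [← Complex.ofReal_natCast, ← Complex.ofReal_inv, Complex.re_ofReal_mul]
  have hone : ∀ k : ι, ((regOp k H * σ).trace).re =
      (m : ℝ)⁻¹ * ∑ v, ((regOp k (Proj v) * regOp k (Proj v) * σ).trace).re := by
    intro k
    rw [hH, regOp_avg', Matrix.smul_mul, Matrix.trace_smul, smul_eq_mul, hre,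
      Matrix.sum_mul, Matrix.trace_sum, Complex.re_sum]
    simp only [regOp_mul', hidem]
  have htwo : ((regOp i H * regOp j H * σ).trace).re =
      (m : ℝ)⁻¹ * ((m : ℝ)⁻¹ * ∑ u, ∑ v,
        ((regOp i (Proj v) * regOp j (Proj u) * σ).trace).re) := by
    rw [hH, regOp_avg', regOp_avg', Matrix.smul_mul, Matrix.mul_smul, Matrix.smul_mul,
      Matrix.smul_mul, Matrix.trace_smul, Matrix.trace_smul, smul_eq_mul, smul_eq_mul, hre, hre]
    congr 2
    simp only [Matrix.mul_sum, Matrix.sum_mul, Matrix.trace_sum, Complex.re_sum]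
  have hA : ∀ (k : ι) u, (regOp k (Proj u))ᴴ = regOp k (Proj u) := fun k u =>
    regOp_herm' k _ (hherm u)
  rw [hone, hone, htwo, hS]
  simp only [trace_inner' _ _ S (hA _ _)]
  exact walk_vec hm μ hμ P hsymm hstoch hgap t
    (fun v (p : (ι → V) × (ι → V)) => (regOp i (Proj v) * S) p.1 p.2)
    (fun v (p : (ι → V) × (ι → V)) => (regOp j (Proj v) * S) p.1 p.2)
end

section
/- Let G = (V, E) be a finite simple graph of maximum degree d. Then there exists a proper vertex coloring of G with d+1 colors that is equitable: the sizes of any two color classes differ by at most 1. -/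
open Finset

namespace HSz
universe u v
open Classical

/-- The fiber of colour `k`. -/
noncomputable def fib {V : Type u} {C : Type v} [Fintype V] (c : V → C) (k : C) : Finset V :=
  Finset.univ.filter (fun v => c v = k)

theorem mem_fib {V : Type u} {C : Type v} [Fintype V] {c : V → C} {k : C} {v : V} :
    v ∈ fib c k ↔ c v = k := by simp [fib]

def Proper {V : Type u} {C : Type v} (G : SimpleGraph V) (c : V → C) : Prop :=
  ∀ u v, G.Adj u v → c u ≠ c v

def Mv {V : Type u} {C : Type v} (G : SimpleGraph V) (c : V → C) (x : V) (k : C) : Prop :=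
  ∀ v, G.Adj x v → c v ≠ k

def Ed {V : Type u} {C : Type v} (G : SimpleGraph V) (c : V → C) (X Y : C) : Prop :=
  ∃ x, c x = X ∧ Mv G c x Y

inductive Reach {C : Type v} (E : C → C → Prop) (a : C) (D : Finset C) : C → Prop
  | base : a ∈ D → Reach E a D a
  | step {X Y : C} : X ∈ D → E X Y → Reach E a D Y → Reach E a D X

section reach
variable {C : Type v} {E : C → C → Prop} {a : C}

theorem Reach.mem {D : Finset C} {X : C} (h : Reach E a D X) : X ∈ D := by
  cases h <;> assumption

theorem Reach.mono {D D' : Finset C} {X : C} (h : Reach E a D X)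
    (hD : ∀ Y, Reach E a D Y → Y ∈ D') : Reach E a D' X := by
  induction h with
  | base h => exact .base (hD _ (.base h))
  | step h e r ih => exact .step (hD _ (.step h e r)) e ih

theorem Reach.avoid {D : Finset C} {X W : C} (h : Reach E a D X) (hW : ¬ Reach E a D W) :
    Reach E a (D.erase W) X :=
  h.mono fun Y hY => Finset.mem_erase.2 ⟨fun e => hW (e ▸ hY), hY.mem⟩

theorem Reach.peel {D : Finset C} {X : C} (h : Reach E a D X) (hX : X ≠ a) :
    ∃ Y, E X Y ∧ Reach E a (D.erase X) Y := by
  have key : ∀ Z, Reach E a D Z → (Reach E a (D.erase X) Z) ∨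
      ∃ Y, E X Y ∧ Reach E a (D.erase X) Y := by
    intro Z hZ
    induction hZ with
    | base h => exact Or.inl (.base (Finset.mem_erase.2 ⟨hX.symm, h⟩))
    | @step P Q h e r ih =>
      rcases ih with ih | ih
      · by_cases hP : P = X
        · subst hP; exact Or.inr ⟨Q, e, ih⟩
        · exact Or.inl (.step (Finset.mem_erase.2 ⟨hP, h⟩) e ih)
      · exact Or.inr ih
  rcases key X h with h | h
  · exact absurd h.mem (by simp)
  · exact h

end reach

theorem shift {V : Type u} {C : Type v} [Fintype V] (G : SimpleGraph V) (a : C) (c : V → C)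
    (hc : Proper G c) (D : Finset C) :
    ∀ z X, c z ∉ D → Mv G c z X → Reach (Ed G c) a D X →
    ∃ c' : V → C, Proper G c' ∧ c' z ∈ D ∧ (∀ v, v ≠ z → c v ∉ D → c' v = c v) ∧
      (∀ v, c v ∈ D → c' v ∈ D) ∧
      (∀ k ∈ D, (fib c' k).card = (fib c k).card + if k = a then 1 else 0) := by
  induction D using Finset.strongInduction with
  | H D IH =>
  intro z X hz hm hr
  have hXD := hr.mem
  by_cases hX : X = a
  · subst hX
    refine ⟨Function.update c z X, ?_, by simpa, ?_, ?_, ?_⟩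
    · intro p q hpq
      by_cases hp : p = z
      · subst hp
        have := hpq.ne'
        simp only [Function.update_self, Function.update_of_ne this]
        exact (hm _ hpq).symm
      · by_cases hq : q = z
        · subst hq
          simp only [Function.update_self, Function.update_of_ne hp]
          exact hm _ hpq.symm
        · simp only [Function.update_of_ne hp, Function.update_of_ne hq]
          exact hc _ _ hpq
    · intro v hv _; simp [hv]
    · intro v hv
      have : v ≠ z := by rintro rfl; exact hz hv
      simpa [this] using hv
    · intro k hk
      by_cases hkX : k = X
      · subst hkX
        have : fib (Function.update c z k) k = insert z (fib c k) := by
          ext v; by_cases hv : v = z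
          · subst hv; simp [mem_fib]
          · simp [mem_fib, hv]
        rw [this, Finset.card_insert_of_notMem]
        · simp
        · rw [mem_fib]; rintro rfl; exact hz hk
      · have : fib (Function.update c z X) k = fib c k := by
          ext v; by_cases hv : v = z
          · subst hv; simp only [mem_fib, Function.update_self]
            constructor
            · intro h; exact absurd h.symm hkX
            · intro h; rw [h] at hz; exact absurd hk hz
          · simp [mem_fib, hv]
        rw [this]; simp [hkX]
  · obtain ⟨Y, ⟨x, hx, hmx⟩, hrY⟩ := hr.peel hX
    obtain ⟨c', h1, h2, h3, h4, h5⟩ := IH (D.erase X) (Finset.erase_ssubset hXD) x Y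
      (by simp [hx]) hmx hrY
    have hzx : z ≠ x := by rintro rfl; rw [hx] at hz; exact hz hXD
    have hcz : c' z = c z := h3 z hzx (fun h => hz (Finset.mem_of_mem_erase h))
    have hXfib : ∀ v, c' v = X ↔ c v = X ∧ v ≠ x := by
      intro v
      constructor
      · intro hv
        have hvx : v ≠ x := by rintro rfl; rw [hv] at h2; simp at h2
        refine ⟨?_, hvx⟩
        by_cases hvD : c v ∈ D.erase X
        · have := h4 v hvD; rw [hv] at this; simp at this
        · rw [← h3 v hvx hvD]; exact hv
      · rintro ⟨hv, hvx⟩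
        rw [h3 v hvx (by simp [hv]), hv]
    have hm' : Mv G c' z X := by
      intro v hv e
      exact hm v hv ((hXfib v).1 e).1
    refine ⟨Function.update c' z X, ?_, by simpa, ?_, ?_, ?_⟩
    · intro p q hpq
      by_cases hp : p = z
      · subst hp
        have := hpq.ne'
        simp only [Function.update_self, Function.update_of_ne this]
        exact (hm' _ hpq).symm
      · by_cases hq : q = z
        · subst hq
          simp only [Function.update_self, Function.update_of_ne hp]
          exact hm' _ hpq.symm
        · simp only [Function.update_of_ne hp, Function.update_of_ne hq]
          exact h1 _ _ hpq
    · intro v hv hvD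
      rw [Function.update_of_ne hv]
      apply h3 v _ (fun h => hvD (Finset.mem_of_mem_erase h))
      rintro rfl; rw [hx] at hvD; exact hvD hXD
    · intro v hv
      have : v ≠ z := by rintro rfl; exact hz hv
      rw [Function.update_of_ne this]
      by_cases hvx : v = x
      · subst hvx; exact Finset.mem_of_mem_erase h2
      · by_cases hvX : c v = X
        · rw [(hXfib v).2 ⟨hvX, hvx⟩]; exact hXD
        · exact Finset.mem_of_mem_erase (h4 v (Finset.mem_erase.2 ⟨hvX, hv⟩))
    · intro k hk
      by_cases hkX : k = X
      · subst hkX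
        have : fib (Function.update c' z k) k = insert z ((fib c k).erase x) := by
          ext v; by_cases hv : v = z
          · subst hv; simp [mem_fib]
          · simp [mem_fib, hv, hXfib]; tauto
        rw [this, Finset.card_insert_of_notMem, Finset.card_erase_add_one]
        · simp [hX]
        · exact mem_fib.2 hx
        · simp only [Finset.mem_erase, mem_fib]; rintro ⟨_, rfl⟩; exact hz hk
      · have : fib (Function.update c' z X) k = fib c' k := by
          ext v; by_cases hv : v = z
          · subst hv; simp only [mem_fib, Function.update_self]
            constructor
            · intro h; exact absurd h.symm hkX
            · intro h; rw [hcz] at h; rw [h] at hz; exact absurd hk hz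
          · simp [mem_fib, hv]
        rw [this]; exact h5 k (Finset.mem_erase.2 ⟨hkX, hk⟩)

structure Near {V : Type u} {C : Type v} [Fintype V] (G : SimpleGraph V) (s : ℕ) (c : V → C)
    (a b : C) : Prop where
  proper : Proper G c
  ne : a ≠ b
  ha : (fib c a).card + 1 = s
  hb : (fib c b).card = s + 1
  ho : ∀ k, k ≠ a → k ≠ b → (fib c k).card = s

def Equi {V : Type u} (C : Type v) [Fintype V] (G : SimpleGraph V) (s : ℕ) : Prop :=
  ∃ c : V → C, Proper G c ∧ ∀ k, (fib c k).card = s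

theorem near_acc {V : Type u} {C : Type v} [Fintype V] [Fintype C] {G : SimpleGraph V} {s : ℕ}
    {c : V → C} {a b : C} (h : Near G s c a b) (hr : Reach (Ed G c) a Finset.univ b) :
    Equi C G s := by
  obtain ⟨Y, ⟨x, hx, hmx⟩, hrY⟩ := hr.peel h.ne.symm
  obtain ⟨c', h1, h2, h3, h4, h5⟩ := shift G a c h.proper _ x Y (by simp [hx]) hmx hrY
  refine ⟨c', h1, fun k => ?_⟩
  by_cases hk : k = b
  · subst hk
    have : fib c' k = (fib c k).erase x := by
      ext v
      simp only [mem_fib, Finset.mem_erase]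
      constructor
      · intro hv
        have hvx : v ≠ x := by rintro rfl; rw [hv] at h2; simp at h2
        refine ⟨hvx, ?_⟩
        by_contra hne
        have := h4 v (by simpa using hne)
        rw [hv] at this; simp at this
      · rintro ⟨hvx, hv⟩
        rw [h3 v hvx (by simp [hv]), hv]
    rw [this, Finset.card_erase_of_mem (mem_fib.2 hx), h.hb]; simp
  · rw [h5 k (by simpa using hk)]
    by_cases hka : k = a
    · subst hka; simpa using h.ha
    · simpa [hka] using h.ho k hka hk

theorem term_struct {C : Type v} [Fintype C] (E : C → C → Prop) (a : C)
    (h0 : ∃ W, W ≠ a ∧ Reach E a Finset.univ W) :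
    ∃ (U : C) (T : Finset C), Reach E a Finset.univ U ∧ T.Nonempty ∧ U ∉ T ∧
      (∀ W ∈ T, Reach E a Finset.univ W ∧ W ≠ a) ∧
      (∀ W ∈ T, ∀ Y, Reach E a Finset.univ Y → Y ≠ W → Reach E a (Finset.univ.erase W) Y) ∧
      (∀ W ∈ T, ∀ Y, Reach E a Finset.univ Y → Y ≠ U → Y ∉ T → ¬ E W Y) := by
  let T : C → Finset C := fun W => Finset.univ.filter (fun Y => Reach E a Finset.univ Y ∧ Y ≠ W ∧
    ¬ Reach E a (Finset.univ.erase W) Y)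
  have hT : ∀ W Y, Y ∈ T W ↔ Reach E a Finset.univ Y ∧ Y ≠ W ∧
    ¬ Reach E a (Finset.univ.erase W) Y := by intro W Y; simp [T]
  have hra : Reach E a Finset.univ a := .base (Finset.mem_univ _)
  let N : Finset C := Finset.univ.filter (fun U => Reach E a Finset.univ U ∧ (T U).Nonempty)
  have hN : N.Nonempty := by
    obtain ⟨W, hW, hrW⟩ := h0
    refine ⟨a, ?_⟩
    simp only [N, Finset.mem_filter, Finset.mem_univ, true_and]
    refine ⟨hra, W, (hT _ _).2 ⟨hrW, hW, ?_⟩⟩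
    intro h
    have : ∀ X, Reach E a (Finset.univ.erase a) X → False := by
      intro X hX
      induction hX with
      | base h => simp at h
      | step _ _ _ ih => exact ih
    exact this _ h
  obtain ⟨U, hU, hmin⟩ := Finset.exists_min_image N (fun U => (T U).card) hN
  simp only [N, Finset.mem_filter, Finset.mem_univ, true_and] at hU hmin
  have hTa : ∀ W ∈ T U, W ≠ a := by
    rintro W hW rfl
    obtain ⟨_, h2, h3⟩ := (hT _ _).1 hW
    exact h3 (.base (by simpa using h2))
  refine ⟨U, T U, hU.1, hU.2, ?_, ?_, ?_, ?_⟩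
  · intro h; exact ((hT _ _).1 h).2.1 rfl
  · intro W hW; exact ⟨((hT _ _).1 hW).1, hTa W hW⟩
  · intro W hW Y hY hYW
    by_contra hn
    obtain ⟨hW1, hW2, hW3⟩ := (hT _ _).1 hW
    have hne : (T W).Nonempty := ⟨Y, (hT _ _).2 ⟨hY, hYW, hn⟩⟩
    have hle := hmin W ⟨hW1, hne⟩
    have hav : ∀ Z, Reach E a (Finset.univ.erase U) Z → Reach E a (Finset.univ.erase W) Z := by
      intro Z hZ
      refine (hZ.avoid hW3).mono ?_
      intro Q hQ
      have := hQ.mem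
      simp at this
      simp [this.1]
    have hUW : Reach E a (Finset.univ.erase W) U := by
      by_cases hUa : U = a
      · subst hUa; exact .base (by simpa using hW2.symm)
      · obtain ⟨Q, hQ, hrQ⟩ := hU.1.peel hUa
        exact .step (by simpa using hW2.symm) hQ (hav _ hrQ)
    have hss : T W ⊂ T U := by
      refine Finset.ssubset_iff_subset_ne.2 ⟨?_, ?_⟩
      · intro Z hZ
        obtain ⟨h1, h2, h3⟩ := (hT _ _).1 hZ
        refine (hT _ _).2 ⟨h1, ?_, fun h => h3 (hav _ h)⟩
        rintro rfl; exact h3 hUW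
      · intro h
        rw [← h] at hW
        exact ((hT _ _).1 hW).2.1 rfl
    have := Finset.card_lt_card hss
    omega
  · intro W hW Y hY hYU hYT hE
    obtain ⟨hW1, hW2, hW3⟩ := (hT _ _).1 hW
    have : Reach E a (Finset.univ.erase U) Y := by
      by_contra h; exact hYT ((hT _ _).2 ⟨hY, hYU, h⟩)
    exact hW3 (.step (by simpa using hW2) hE this)

noncomputable def nb {V : Type u} {C : Type v} [Fintype V] (G : SimpleGraph V) (c : V → C)
    (v : V) (k : C) : ℕ := (Finset.univ.filter (fun w => G.Adj v w ∧ c w = k)).card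

noncomputable def dg {V : Type u} {C : Type v} [Fintype V] (G : SimpleGraph V) (c : V → C)
    (v : V) (K : Finset C) : ℕ := (Finset.univ.filter (fun w => G.Adj v w ∧ c w ∈ K)).card

section count
variable {V : Type u} {C : Type v} [Fintype V] [Fintype C] {G : SimpleGraph V} {c : V → C}

theorem dg_sum (v : V) (K : Finset C) : dg G c v K = ∑ k ∈ K, nb G c v k := by
  unfold dg nb
  rw [Finset.card_eq_sum_card_fiberwise (f := c) (t := K)]
  · apply Finset.sum_congr rfl
    intro k hk
    congr 1
    ext w
    simp only [Finset.mem_filter, Finset.mem_univ, true_and]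
    constructor
    · rintro ⟨⟨h1, h2⟩, h3⟩; exact ⟨h1, h3⟩
    · rintro ⟨h1, rfl⟩; exact ⟨⟨h1, hk⟩, rfl⟩
  · intro w hw
    simp at hw
    exact hw.2

theorem dg_compl (v : V) (K : Finset C) :
    dg G c v K + dg G c v Kᶜ = (Finset.univ.filter (fun w => G.Adj v w)).card := by
  unfold dg
  rw [← Finset.card_filter_add_card_filter_not (s := Finset.univ.filter (fun w => G.Adj v w))
    (fun w => c w ∈ K)]
  simp [Finset.filter_filter]

theorem nb_pos {v : V} {k : C} (h : ¬ Mv G c v k) : 1 ≤ nb G c v k := by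
  unfold Mv at h
  push Not at h
  obtain ⟨w, h1, h2⟩ := h
  exact Finset.card_pos.2 ⟨w, by simp [h1, h2]⟩

theorem lower (A K : Finset C) (hK : K ⊆ A) (v : V)
    (hdeg : (Finset.univ.filter (fun w => G.Adj v w)).card < Fintype.card C)
    (h : ∀ k ∈ K, ¬ Mv G c v k) : dg G c v Aᶜ + K.card < Fintype.card C := by
  have h1 := dg_compl (G := G) (c := c) v A
  have h2 : K.card ≤ dg G c v A := by
    rw [dg_sum]
    calc K.card = ∑ k ∈ K, 1 := by simp
      _ ≤ ∑ k ∈ K, nb G c v k := Finset.sum_le_sum fun k hk => nb_pos (h k hk)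
      _ ≤ _ := Finset.sum_le_sum_of_subset hK
  omega

theorem sigma_bound (A T : Finset C) (hT : T ⊆ A) (v : V)
    (hdeg : (Finset.univ.filter (fun w => G.Adj v w)).card < Fintype.card C)
    (h : ∀ k ∈ A, ¬ Mv G c v k) :
    dg G c v Aᶜ + A.card + T.card < Fintype.card C + (T.filter (fun k => nb G c v k = 1)).card := by
  have h1 := dg_compl (G := G) (c := c) v A
  have h2 : A.card + T.card ≤ dg G c v A + (T.filter (fun k => nb G c v k = 1)).card := by
    rw [dg_sum]
    have e1 : A.card = ∑ k ∈ A, 1 := by simp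
    have e2 : T.card = ∑ k ∈ A, if k ∈ T then 1 else 0 := by
      rw [Finset.sum_ite_mem, Finset.inter_eq_right.2 hT]; simp
    have e3 : (T.filter (fun k => nb G c v k = 1)).card =
        ∑ k ∈ A, if k ∈ T.filter (fun k => nb G c v k = 1) then 1 else 0 := by
      rw [Finset.sum_ite_mem, Finset.inter_eq_right.2 ((Finset.filter_subset _ _).trans hT)]; simp
    rw [e1, e2, e3, ← Finset.sum_add_distrib, ← Finset.sum_add_distrib]
    apply Finset.sum_le_sum
    intro k hk
    have := nb_pos (h k hk)
    by_cases hkT : k ∈ T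
    · by_cases h1 : nb G c v k = 1
      · simp [hkT, h1]
      · simp [hkT, h1]; omega
    · simp [hkT]; omega
  omega

theorem lemma2 (A : Finset C) (W : C) (s q t : ℕ) (hW : (fib c W).card = s)
    (hB : (Finset.univ.filter (fun v => c v ∉ A)).card = q * s + 1)
    (hpos : ∀ y, c y ∉ A → 1 ≤ nb G c y W)
    (hS : ∀ z, c z = W → (∃ y, c y ∉ A ∧ G.Adj z y ∧ nb G c y W = 1) → dg G c z Aᶜ ≤ q)
    (hD : ∀ z, c z = W → dg G c z Aᶜ ≤ q + t) : q < t := by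
  by_contra hqt
  push Not at hqt
  let w : V → ℕ := fun z => if (∃ y, c y ∉ A ∧ G.Adj z y ∧ nb G c y W = 1) then 2 else 1
  have hw1 : ∀ z, 1 ≤ w z := by intro z; simp only [w]; split_ifs <;> omega
  have key1 : ∀ y ∈ Finset.univ.filter (fun v => c v ∉ A),
      2 ≤ ∑ z ∈ fib c W, if G.Adj z y then w z else 0 := by
    intro y hy
    simp only [Finset.mem_filter, Finset.mem_univ, true_and] at hy
    rw [← Finset.sum_filter]
    have hset : (Finset.univ.filter (fun z => G.Adj y z ∧ c z = W)) =
        (fib c W).filter (fun z => G.Adj z y) := by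
      ext z; simp [mem_fib, G.adj_comm, and_comm]
    have hp := hpos y hy
    by_cases h1 : nb G c y W = 1
    · have h1' := h1
      unfold nb at hp
      rw [hset] at hp
      obtain ⟨z, hz⟩ := Finset.card_pos.1 hp
      have hz' := hz
      simp only [Finset.mem_filter, mem_fib] at hz
      calc 2 = w z := by
            have : ∃ y, c y ∉ A ∧ G.Adj z y ∧ nb G c y W = 1 := ⟨y, hy, hz.2, h1⟩
            simp only [w]; rw [if_pos this]
        _ ≤ _ := Finset.single_le_sum (f := w) (fun _ _ => Nat.zero_le _) hz'
    · calc 2 ≤ nb G c y W := by omega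
        _ = ∑ z ∈ (fib c W).filter (fun z => G.Adj z y), 1 := by
            unfold nb; rw [hset]; simp
        _ ≤ _ := Finset.sum_le_sum fun z _ => hw1 z
  have key2 : ∀ z ∈ fib c W, (∑ y ∈ Finset.univ.filter (fun v => c v ∉ A),
      if G.Adj z y then w z else 0) ≤ 2 * q := by
    intro z hz
    rw [mem_fib] at hz
    rw [← Finset.sum_filter, Finset.sum_const, Finset.filter_filter]
    have : (Finset.univ.filter (fun y => c y ∉ A ∧ G.Adj z y)).card = dg G c z Aᶜ := by
      unfold dg; congr 1; ext y; simp [and_comm]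
    rw [this, smul_eq_mul]
    have hd := hD z hz
    by_cases h : ∃ y, c y ∉ A ∧ G.Adj z y ∧ nb G c y W = 1
    · have := hS z hz h
      simp only [w]; rw [if_pos h]; omega
    · simp only [w]; rw [if_neg h]; omega
  have h1 := Finset.sum_le_sum key1
  have h2 := Finset.sum_le_sum key2
  rw [Finset.sum_comm] at h1
  have h3 := h1.trans h2
  simp only [Finset.sum_const, smul_eq_mul, hB, hW] at h3
  nlinarith

theorem indep (A T : Finset C) (s q : ℕ)
    (hB : (Finset.univ.filter (fun v => c v ∉ A)).card = q * s + 1)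
    (hA : (Finset.univ.filter (fun v => c v ∈ T)).card = T.card * s)
    (hq : ∀ y, c y ∉ A → dg G c y Aᶜ + 1 ≤ q) (hqt : q ≤ T.card)
    (hs : ∀ y, c y ∉ A → dg G c y Aᶜ + 1 + T.card ≤
      q + (T.filter (fun k => nb G c y k = 1)).card) :
    ∃ z y₁ y₂, c z ∈ T ∧ c y₁ ∉ A ∧ c y₂ ∉ A ∧ y₁ ≠ y₂ ∧ ¬ G.Adj y₁ y₂ ∧ G.Adj z y₁ ∧ G.Adj z y₂ ∧
      nb G c y₁ (c z) = 1 ∧ nb G c y₂ (c z) = 1 := by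
  let B := Finset.univ.filter (fun v => c v ∉ A)
  have hBm : ∀ y, y ∈ B ↔ c y ∉ A := by intro y; simp [B]
  let F := B.powerset.filter (fun I => ∀ x ∈ I, ∀ y ∈ I, ¬ G.Adj x y)
  have hF : F.Nonempty := ⟨∅, by simp [F]⟩
  obtain ⟨I, hI, hmax⟩ := Finset.exists_max_image F Finset.card hF
  simp only [F, Finset.mem_filter, Finset.mem_powerset] at hI hmax
  obtain ⟨hIB, hind⟩ := hI
  have hcov : ∀ v ∈ B, ∃ y ∈ I, v = y ∨ G.Adj y v := by
    intro v hv
    by_contra hn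
    push Not at hn
    have hvI : v ∉ I := fun h => (hn v h).1 rfl
    have := hmax (insert v I) ⟨Finset.insert_subset hv hIB, ?_⟩
    · rw [Finset.card_insert_of_notMem hvI] at this; omega
    · intro x hx y hy
      rcases Finset.mem_insert.1 hx with rfl | hx2
      · rcases Finset.mem_insert.1 hy with rfl | hy2
        · exact G.loopless.irrefl _
        · exact fun h => (hn y hy2).2 h.symm
      · rcases Finset.mem_insert.1 hy with rfl | hy2
        · exact (hn x hx2).2
        · exact hind x hx2 y hy2
  have hsum : q * s + 1 ≤ ∑ y ∈ I, (dg G c y Aᶜ + 1) := by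
    rw [← hB]
    calc B.card ≤ (I.biUnion (fun y => insert y
            (Finset.univ.filter (fun w => G.Adj y w ∧ c w ∈ Aᶜ)))).card := by
          apply Finset.card_le_card
          intro v hv
          obtain ⟨y, hy, h⟩ := hcov v hv
          have hv' := (hBm v).1 hv
          simp only [Finset.mem_biUnion, Finset.mem_insert, Finset.mem_filter, Finset.mem_univ,
            true_and, Finset.mem_compl]
          exact ⟨y, hy, h.imp id fun h => ⟨h, hv'⟩⟩
      _ ≤ ∑ y ∈ I, (insert y
            (Finset.univ.filter (fun w => G.Adj y w ∧ c w ∈ Aᶜ))).card := Finset.card_biUnion_le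
      _ ≤ _ := Finset.sum_le_sum fun y _ => Finset.card_insert_le _ _
  have hIs : s + 1 ≤ I.card := by
    have : ∑ y ∈ I, (dg G c y Aᶜ + 1) ≤ ∑ y ∈ I, q :=
      Finset.sum_le_sum fun y hy => hq y ((hBm y).1 (hIB hy))
    simp only [Finset.sum_const, smul_eq_mul] at this
    by_contra h
    have h' : I.card ≤ s := by omega
    have := Nat.mul_le_mul_right q h'
    nlinarith
  let P : V → V → Prop := fun z y => G.Adj z y ∧ nb G c y (c z) = 1
  let A' := Finset.univ.filter (fun v => c v ∈ T)
  have hσ : ∀ y, (T.filter (fun k => nb G c y k = 1)).card ≤ (A'.filter (fun z => P z y)).card := by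
    intro y
    calc _ ≤ ((A'.filter (fun z => P z y)).image c).card := by
          apply Finset.card_le_card
          intro k hk
          simp only [Finset.mem_filter] at hk
          have : 0 < nb G c y k := by omega
          obtain ⟨z, hz⟩ := Finset.card_pos.1 this
          simp only [Finset.mem_filter, Finset.mem_univ, true_and] at hz
          refine Finset.mem_image.2 ⟨z, ?_, hz.2⟩
          simp only [A', P, Finset.mem_filter, Finset.mem_univ, true_and, hz.2]
          exact ⟨hk.1, hz.1.symm, hk.2⟩
      _ ≤ _ := Finset.card_image_le
  have htot : T.card * s + 1 ≤ ∑ y ∈ I, (A'.filter (fun z => P z y)).card := by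
    have h1 : ∑ y ∈ I, (dg G c y Aᶜ + 1 + T.card) ≤
        ∑ y ∈ I, (q + (A'.filter (fun z => P z y)).card) :=
      Finset.sum_le_sum fun y hy => (hs y ((hBm y).1 (hIB hy))).trans (by have := hσ y; omega)
    rw [Finset.sum_add_distrib, Finset.sum_add_distrib (f := fun _ => q)] at h1
    simp only [Finset.sum_const, smul_eq_mul] at h1
    obtain ⟨e, he⟩ := Nat.exists_eq_add_of_le hqt
    rw [he] at h1 ⊢
    have : e * (s + 1) ≤ e * I.card := Nat.mul_le_mul_left e hIs
    nlinarith
  have hdc : ∑ y ∈ I, (A'.filter (fun z => P z y)).card =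
      ∑ z ∈ A', (I.filter (fun y => P z y)).card := by
    simp only [Finset.card_filter]
    exact Finset.sum_comm
  have : ∑ z ∈ A', 1 < ∑ z ∈ A', (I.filter (fun y => P z y)).card := by
    rw [← hdc]; simp only [Finset.sum_const, smul_eq_mul, mul_one]
    have : A'.card = T.card * s := hA
    omega
  obtain ⟨z, hz, hlt⟩ := Finset.exists_lt_of_sum_lt this
  obtain ⟨y₁, hy₁, y₂, hy₂, hne⟩ := Finset.one_lt_card.1 hlt
  simp only [Finset.mem_filter, P] at hy₁ hy₂
  have hz' : c z ∈ T := by simpa [A'] using hz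
  exact ⟨z, y₁, y₂, hz', (hBm _).1 (hIB hy₁.1), (hBm _).1 (hIB hy₂.1), hne,
    hind _ hy₁.1 _ hy₂.1, hy₁.2.1, hy₂.2.1, hy₁.2.2, hy₂.2.2⟩

end count

section cases
variable {V : Type u} {C : Type v} [Fintype V] [Fintype C] {G : SimpleGraph V} {c : V → C}

theorem nb_uniq {y z w : V} {W : C} (h : nb G c y W = 1) (hz : G.Adj y z) (hcz : c z = W)
    (hw : G.Adj y w) (hcw : c w = W) : w = z := by
  unfold nb at h
  exact Finset.card_le_one.1 h.le w (by simp [hw, hcw]) z (by simp [hz, hcz])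

theorem case1 {s : ℕ} {a b : C} (h : Near G s c a b) (A : Finset C)
    (hA : ∀ k, k ∈ A ↔ Reach (Ed G c) a Finset.univ k) (hb : b ∉ A) (z y : V) (X : C)
    (hWa : c z ≠ a) (hW : c z ∈ A) (hy : c y ∉ A) (hadj : G.Adj z y)
    (hnb : nb G c y (c z) = 1) (hm : Mv G c z X)
    (hX : Reach (Ed G c) a (Finset.univ.erase (c z)) X) (g : V → C)
    (hg1 : ∀ v, c v ∉ A → v ≠ y → g v ∉ A)
    (hg2 : ∀ v w, c v ∉ A → v ≠ y → c w ∉ A → w ≠ y → G.Adj v w → g v ≠ g w)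
    (hg3 : ∀ k, k ∉ A → (Finset.univ.filter (fun v => (c v ∉ A ∧ v ≠ y) ∧ g v = k)).card = s) :
    Equi C G s := by
  have hX' : Reach (Ed G c) a (A.erase (c z)) X := by
    refine hX.mono fun Y hY => Finset.mem_erase.2 ⟨?_, (hA Y).2 (hY.mono fun _ _ => by simp)⟩
    have := hY.mem; simpa using this
  obtain ⟨c', h1, h2, h3, h4, h5⟩ := shift G a c h.proper _ z X (by simp) hm hX'
  have hyz : y ≠ z := hadj.ne'
  have hAin : ∀ v, c v ∈ A → c' v ∈ A := by
    intro v hv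
    by_cases hvz : v = z
    · subst hvz; exact Finset.mem_of_mem_erase h2
    · by_cases hvW : c v = c z
      · rw [h3 v hvz (by simp [hvW])]; exact hv
      · exact Finset.mem_of_mem_erase (h4 v (Finset.mem_erase.2 ⟨hvW, hv⟩))
  have hW' : ∀ v, c' v = c z ↔ c v = c z ∧ v ≠ z := by
    intro v
    constructor
    · intro hv
      have hvx : v ≠ z := by rintro rfl; rw [hv] at h2; simp at h2
      refine ⟨?_, hvx⟩
      by_cases hvD : c v ∈ A.erase (c z)
      · have := h4 v hvD; rw [hv] at this; simp at this
      · rw [← h3 v hvx hvD]; exact hv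
    · rintro ⟨hv, hvx⟩
      rw [h3 v hvx (by simp [hv]), hv]
  have hBc : ∀ v, c v ∉ A → c' v = c v := by
    intro v hv
    exact h3 v (by rintro rfl; exact hv hW) (fun h => hv (Finset.mem_of_mem_erase h))
  let f : V → C := fun v => if v = y then c z else if c v ∈ A then c' v else g v
  have fy : f y = c z := by simp [f]
  have fA : ∀ v, c v ∈ A → f v = c' v := by
    intro v hv
    have : v ≠ y := by rintro rfl; exact hy hv
    simp [f, this, hv]
  have fB : ∀ v, c v ∉ A → v ≠ y → f v = g v := by
    intro v hv hvy; simp [f, hv, hvy]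
  have yA : ∀ w, c w ∈ A → G.Adj y w → f y ≠ f w := by
    intro w hw hyw e
    rw [fy, fA w hw] at e
    obtain ⟨e1, e2⟩ := (hW' w).1 e.symm
    exact e2 (nb_uniq hnb hadj.symm rfl hyw e1)
  have BA : ∀ v w, c v ∉ A → v ≠ y → (c w ∈ A ∨ w = y) → f v ≠ f w := by
    intro v w hv hvy hw e
    apply hg1 v hv hvy
    rw [← fB v hv hvy, e]
    rcases hw with hw | rfl
    · rw [fA w hw]; exact hAin w hw
    · rw [fy]; exact hW
  refine ⟨f, ?_, ?_⟩
  · intro v w hvw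
    by_cases hv : c v ∈ A
    · by_cases hw : c w ∈ A
      · rw [fA v hv, fA w hw]; exact h1 _ _ hvw
      · by_cases hwy : w = y
        · subst hwy; exact (yA v hv hvw.symm).symm
        · exact (BA w v hw hwy (Or.inl hv)).symm
    · by_cases hvy : v = y
      · subst hvy
        by_cases hw : c w ∈ A
        · exact yA w hw hvw
        · exact (BA w v hw hvw.ne' (Or.inr rfl)).symm
      · by_cases hw : c w ∈ A
        · exact BA v w hv hvy (Or.inl hw)
        · by_cases hwy : w = y
          · exact BA v w hv hvy (Or.inr hwy)
          · rw [fB v hv hvy, fB w hw hwy]; exact hg2 v w hv hvy hw hwy hvw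
  · intro k
    by_cases hk : k ∈ A
    · by_cases hkW : k = c z
      · have : fib f k = insert y ((fib c k).erase z) := by
          ext v
          simp only [mem_fib, Finset.mem_insert, Finset.mem_erase]
          by_cases hvy : v = y
          · subst hvy; simp [fy, hkW]
          · by_cases hv : c v ∈ A
            · rw [fA v hv, hkW, hW']; simp [hvy]; tauto
            · have h1 : f v ≠ k := by
                rw [fB v hv hvy]; rintro rfl; exact hg1 v hv hvy hk
              have h2 : c v ≠ k := by rintro rfl; exact hv hk
              simp [h1, h2, hvy]
        rw [this, Finset.card_insert_of_notMem, Finset.card_erase_add_one]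
        · exact h.ho k (hkW ▸ hWa) (by rintro rfl; exact hb hk)
        · exact mem_fib.2 hkW.symm
        · simp only [Finset.mem_erase, mem_fib]; rintro ⟨_, rfl⟩; exact hy hk
      · have : fib f k = fib c' k := by
          ext v
          simp only [mem_fib]
          by_cases hv : c v ∈ A
          · rw [fA v hv]
          · have h2 : c' v ≠ k := by rw [hBc v hv]; rintro rfl; exact hv hk
            have h1 : f v ≠ k := by
              by_cases hvy : v = y
              · subst hvy; rw [fy]; exact fun h => hkW h.symm
              · rw [fB v hv hvy]; rintro rfl; exact hg1 v hv hvy hk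
            simp [h1, h2]
        rw [this, h5 k (Finset.mem_erase.2 ⟨hkW, hk⟩)]
        by_cases hka : k = a
        · subst hka; simpa using h.ha
        · simpa [hka] using h.ho k hka (by rintro rfl; exact hb hk)
    · rw [← hg3 k hk]
      congr 1
      ext v
      simp only [mem_fib, Finset.mem_filter, Finset.mem_univ, true_and]
      constructor
      · intro hv
        have hvA : c v ∉ A := by
          intro h; apply hk; rw [← hv, fA v h]; exact hAin v h
        have hvy : v ≠ y := by
          rintro rfl; apply hk; rw [← hv, fy]; exact hW
        exact ⟨⟨hvA, hvy⟩, by rw [← fB v hvA hvy]; exact hv⟩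
      · rintro ⟨⟨h1, h2⟩, h3⟩
        rw [fB v h1 h2]; exact h3

theorem case2 {s : ℕ} {a b : C} (h : Near G s c a b) (A : Finset C)
    (hA : ∀ k, k ∈ A ↔ Reach (Ed G c) a Finset.univ k) (hb : b ∉ A) (z y y₂ : V) (X : C)
    (hWa : c z ≠ a) (hW : c z ∈ A) (hy : c y ∉ A) (hadj : G.Adj z y)
    (hnb : nb G c y (c z) = 1)
    (hy₂ : c y₂ ∉ A) (hadj₂ : G.Adj z y₂) (hnb₂ : nb G c y₂ (c z) = 1)
    (hne : y ≠ y₂) (hna : ¬ G.Adj y y₂)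
    (hnm : ∀ k ∈ A, k ≠ c z → ¬ Mv G c z k)
    (hterm : ∀ k ∈ A, k ≠ c z → Reach (Ed G c) a (Finset.univ.erase (c z)) k) (g : V → C)
    (hg1 : ∀ v, c v ∉ A → v ≠ y → g v ∉ A)
    (hg2 : ∀ v w, c v ∉ A → v ≠ y → c w ∉ A → w ≠ y → G.Adj v w → g v ≠ g w)
    (hg3 : ∀ k, k ∉ A → (Finset.univ.filter (fun v => (c v ∉ A ∧ v ≠ y) ∧ g v = k)).card = s)
    (hXA : X ∉ A) (hX : ∀ v, c v ∉ A → v ≠ y → G.Adj z v → g v ≠ X) :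
    ∃ f : V → C, Near G s f a X ∧ (∀ k ∈ A, Reach (Ed G f) a Finset.univ k) ∧
      ∃ k, k ∉ A ∧ Reach (Ed G f) a Finset.univ k := by
  have hyz : y ≠ z := hadj.ne'
  have haA : a ∈ A := (hA a).2 (.base (by simp))
  let f : V → C := fun v => if v = y then c z else if v = z then X else if c v ∈ A then c v else g v
  have fy : f y = c z := by simp [f]
  have fz : f z = X := by simp [f, hyz.symm]
  have fA : ∀ v, c v ∈ A → v ≠ z → f v = c v := by
    intro v hv hvz
    have : v ≠ y := by rintro rfl; exact hy hv
    simp [f, this, hv, hvz]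
  have fB : ∀ v, c v ∉ A → v ≠ y → f v = g v := by
    intro v hv hvy
    have : v ≠ z := by rintro rfl; exact hv hW
    simp [f, hv, hvy, this]
  -- colours in A
  have fin : ∀ v, f v ∈ A → v = y ∨ (c v ∈ A ∧ v ≠ z ∧ f v = c v) := by
    intro v hv
    by_cases hvy : v = y
    · exact Or.inl hvy
    · right
      have hvz : v ≠ z := by rintro rfl; rw [fz] at hv; exact hXA hv
      have hvA : c v ∈ A := by
        by_contra hn; rw [fB v hn hvy] at hv; exact hg1 v hn hvy hv
      exact ⟨hvA, hvz, fA v hvA hvz⟩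
  have fout : ∀ v, f v ∉ A → v = z ∨ (c v ∉ A ∧ v ≠ y ∧ f v = g v) := by
    intro v hv
    by_cases hvz : v = z
    · exact Or.inl hvz
    · right
      have hvy : v ≠ y := by rintro rfl; rw [fy] at hv; exact hv hW
      have hvA : c v ∉ A := by
        intro hn; rw [fA v hn hvz] at hv; exact hv hn
      exact ⟨hvA, hvy, fB v hvA hvy⟩
  have hmv : ∀ x k, k ∈ A → k ≠ c z → Mv G c x k → Mv G f x k := by
    intro x k hk hkz hm v hv e
    rcases fin v (e ▸ hk) with rfl | ⟨_, _, h3⟩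
    · rw [fy] at e; exact hkz e.symm
    · exact hm v hv (h3 ▸ e)
  have hr1 : ∀ k, Reach (Ed G c) a (A.erase (c z)) k → Reach (Ed G f) a Finset.univ k := by
    intro k hk
    induction hk with
    | base _ => exact .base (by simp)
    | @step P Q hP e r ih =>
      obtain ⟨x, hx, hm⟩ := e
      have hP' := Finset.mem_erase.1 hP
      have hQ := Finset.mem_erase.1 r.mem
      have hxz : x ≠ z := by rintro rfl; exact hP'.1 hx.symm
      exact .step (by simp) ⟨x, by rw [fA x (hx ▸ hP'.2) hxz, hx], hmv x Q hQ.2 hQ.1 hm⟩ ih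
  have hre : ∀ k, Reach (Ed G c) a (Finset.univ.erase (c z)) k →
      Reach (Ed G c) a (A.erase (c z)) k := by
    intro k hk
    refine hk.mono fun Y hY => Finset.mem_erase.2 ⟨?_, (hA Y).2 (hY.mono fun _ _ => by simp)⟩
    have := hY.mem; simpa using this
  have hrW : Reach (Ed G f) a Finset.univ (c z) := by
    obtain ⟨Y, ⟨x, hx, hm⟩, hrY⟩ := ((hA _).1 hW).peel hWa
    have hY := Finset.mem_erase.1 (hre Y hrY).mem
    have hxz : x ≠ z := by rintro rfl; exact hnm Y hY.2 hY.1 hm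
    exact .step (by simp) ⟨x, by rw [fA x (hx ▸ hW) hxz, hx], hmv x Y hY.2 hY.1 hm⟩
      (hr1 Y (hre Y hrY))
  refine ⟨f, ⟨?_, ?_, ?_, ?_, ?_⟩, ?_, ?_⟩
  · intro v w hvw e
    by_cases hv : f v ∈ A
    · have hw : f w ∈ A := e ▸ hv
      rcases fin v hv with rfl | ⟨v1, v2, v3⟩
      · rcases fin w hw with rfl | ⟨w1, w2, w3⟩
        · exact hvw.ne rfl
        · exact w2 (nb_uniq hnb hadj.symm rfl hvw (by rw [← w3, ← e, fy]))
      · rcases fin w hw with rfl | ⟨w1, w2, w3⟩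
        · exact v2 (nb_uniq hnb hadj.symm rfl hvw.symm (by rw [← v3, e, fy]))
        · exact h.proper v w hvw (by rw [← v3, ← w3, e])
    · have hw : f w ∉ A := e ▸ hv
      rcases fout v hv with rfl | ⟨v1, v2, v3⟩
      · rcases fout w hw with rfl | ⟨w1, w2, w3⟩
        · exact hvw.ne rfl
        · exact hX w w1 w2 hvw (by rw [← w3, ← e, fz])
      · rcases fout w hw with rfl | ⟨w1, w2, w3⟩
        · exact hX v v1 v2 hvw.symm (by rw [← v3, e, fz])
        · exact hg2 v w v1 v2 w1 w2 hvw (by rw [← v3, ← w3, e])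
  · rintro rfl; exact hXA haA
  · rw [← h.ha]
    congr 2
    ext v
    simp only [mem_fib]
    constructor
    · intro hv
      rcases fin v (hv ▸ haA) with rfl | ⟨v1, v2, v3⟩
      · rw [fy] at hv; exact absurd hv hWa
      · rw [← v3, hv]
    · intro hv
      rw [fA v (hv ▸ haA) (by rintro rfl; exact hWa hv), hv]
  · rw [← hg3 X hXA]
    have : fib f X = insert z (Finset.univ.filter (fun v => (c v ∉ A ∧ v ≠ y) ∧ g v = X)) := by
      ext v
      simp only [mem_fib, Finset.mem_filter, Finset.mem_univ, true_and, Finset.mem_insert]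
      constructor
      · intro hv
        rcases fout v (hv ▸ hXA) with rfl | ⟨v1, v2, v3⟩
        · exact Or.inl rfl
        · exact Or.inr ⟨⟨v1, v2⟩, v3 ▸ hv⟩
      · rintro (rfl | ⟨⟨v1, v2⟩, v3⟩)
        · exact fz
        · rw [fB v v1 v2, v3]
    rw [this, Finset.card_insert_of_notMem]
    simp [hW]
  · intro k hka hkX
    by_cases hk : k ∈ A
    · have hs := h.ho k hka (by rintro rfl; exact hb hk)
      rw [← hs]
      by_cases hkW : k = c z
      · have : fib f k = insert y ((fib c k).erase z) := by
          ext v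
          simp only [mem_fib, Finset.mem_insert, Finset.mem_erase]
          constructor
          · intro hv
            rcases fin v (hv ▸ hk) with rfl | ⟨v1, v2, v3⟩
            · exact Or.inl rfl
            · exact Or.inr ⟨v2, v3 ▸ hv⟩
          · rintro (rfl | ⟨v1, v2⟩)
            · rw [fy, hkW]
            · rw [fA v (v2 ▸ hk) v1, v2]
        rw [this, Finset.card_insert_of_notMem, Finset.card_erase_add_one]
        · exact mem_fib.2 hkW.symm
        · simp only [Finset.mem_erase, mem_fib]; rintro ⟨_, rfl⟩; exact hy hk
      · congr 1
        ext v
        simp only [mem_fib]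
        constructor
        · intro hv
          rcases fin v (hv ▸ hk) with rfl | ⟨v1, v2, v3⟩
          · rw [fy] at hv; exact absurd hv.symm hkW
          · rw [← v3, hv]
        · intro hv
          rw [fA v (hv ▸ hk) (by rintro rfl; exact hkW hv.symm), hv]
    · rw [← hg3 k hk]
      congr 1
      ext v
      simp only [mem_fib, Finset.mem_filter, Finset.mem_univ, true_and]
      constructor
      · intro hv
        rcases fout v (hv ▸ hk) with rfl | ⟨v1, v2, v3⟩
        · rw [fz] at hv; exact absurd hv.symm hkX
        · exact ⟨⟨v1, v2⟩, v3 ▸ hv⟩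
      · rintro ⟨⟨v1, v2⟩, v3⟩
        rw [fB v v1 v2, v3]
  · intro k hk
    by_cases hkW : k = c z
    · rw [hkW]; exact hrW
    · exact hr1 k (hre k (hterm k hk hkW))
  · refine ⟨g y₂, hg1 y₂ hy₂ hne.symm, .step (by simp) ⟨y₂, fB y₂ hy₂ hne.symm, ?_⟩ hrW⟩
    intro v hv e
    rcases fin v (e ▸ hW) with rfl | ⟨v1, v2, v3⟩
    · exact hna hv.symm
    · exact v2 (nb_uniq hnb₂ hadj₂.symm rfl hv (v3 ▸ e))

end cases

theorem card_fibs {V : Type u} {C : Type v} [Fintype V] (c : V → C) (K : Finset C) :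
    (Finset.univ.filter (fun v => c v ∈ K)).card = ∑ k ∈ K, (fib c k).card := by
  rw [Finset.card_eq_sum_card_fiberwise (f := c) (t := K)]
  · apply Finset.sum_congr rfl
    intro k hk
    congr 1
    ext w
    simp only [Finset.mem_filter, Finset.mem_univ, true_and, mem_fib]
    constructor
    · rintro ⟨_, h3⟩; exact h3
    · rintro rfl; exact ⟨hk, rfl⟩
  · intro w hw
    simpa using hw

def FinIH (V : Type u) (C : Type v) [Fintype V] [Fintype C] (G : SimpleGraph V) (s : ℕ) : Prop :=
  ∀ (B : Finset V) (K : Finset C), K.card < Fintype.card C →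
    (∀ v ∈ B, (B.filter (fun w => G.Adj v w)).card < K.card) → B.card = s * K.card →
    ∃ g : V → C, (∀ v ∈ B, g v ∈ K) ∧ (∀ v ∈ B, ∀ w ∈ B, G.Adj v w → g v ≠ g w) ∧
      ∀ k ∈ K, (B.filter (fun v => g v = k)).card = s

theorem near_step {V : Type u} {C : Type v} [Fintype V] [Fintype C] {G : SimpleGraph V}
    {s : ℕ} (hdeg : ∀ v, (Finset.univ.filter (fun w => G.Adj v w)).card < Fintype.card C)
    (IH : FinIH V C G s) {c : V → C} {a b : C} (h : Near G s c a b) (A : Finset C)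
    (hA : ∀ k, k ∈ A ↔ Reach (Ed G c) a Finset.univ k) :
    Equi C G s ∨ ∃ (f : V → C) (X : C), Near G s f a X ∧
      (∀ k ∈ A, Reach (Ed G f) a Finset.univ k) ∧
      ∃ k, k ∉ A ∧ Reach (Ed G f) a Finset.univ k := by
  by_cases hb : b ∈ A
  · exact Or.inl (near_acc h ((hA b).1 hb))
  have haA : a ∈ A := (hA a).2 (.base (by simp))
  have hMq : A.card + Aᶜ.card = Fintype.card C := Finset.card_add_card_compl A
  have hAs : ∀ k ∈ A, k ≠ a → (fib c k).card = s := fun k hk hka =>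
    h.ho k hka (by rintro rfl; exact hb hk)
  have hnomv : ∀ y, c y ∉ A → ∀ k ∈ A, ¬ Mv G c y k := by
    intro y hy k hk hm
    exact hy ((hA _).2 (.step (by simp) ⟨y, rfl, hm⟩ ((hA k).1 hk)))
  have hB : (Finset.univ.filter (fun v => c v ∉ A)).card = Aᶜ.card * s + 1 := by
    have h1 := card_fibs c Aᶜ
    simp only [Finset.mem_compl] at h1
    rw [h1]
    have hb' : b ∈ Aᶜ := by simpa using hb
    rw [← Finset.add_sum_erase _ _ hb', h.hb, Finset.sum_congr rfl (g := fun _ => s)]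
    · rw [Finset.sum_const, Finset.card_erase_of_mem hb', smul_eq_mul]
      have : 0 < Aᶜ.card := Finset.card_pos.2 ⟨b, hb'⟩
      obtain ⟨n, hn⟩ : ∃ n, Aᶜ.card = n + 1 := ⟨Aᶜ.card - 1, by omega⟩
      rw [hn]; simp; ring
    · intro k hk
      obtain ⟨h1, h2⟩ := Finset.mem_erase.1 hk
      exact h.ho k (by rintro rfl; simp at h2; exact h2 haA) h1
  have hdB : ∀ y, c y ∉ A → dg G c y Aᶜ + 1 ≤ Aᶜ.card := by
    intro y hy
    have := lower A A (Finset.Subset.refl _) y (hdeg y) (hnomv y hy)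
    omega
  have hm1 : ∃ W, W ≠ a ∧ Reach (Ed G c) a Finset.univ W := by
    by_contra hn
    push Not at hn
    have hA1 : A = {a} := by
      ext k; simp only [Finset.mem_singleton]
      constructor
      · intro hk; by_contra hka; exact hn k hka ((hA k).1 hk)
      · rintro rfl; exact haA
    have hle : (Finset.univ.filter (fun v => c v ∉ A)).card ≤ (fib c a).card * Aᶜ.card := by
      calc _ ≤ ((fib c a).biUnion (fun x => Finset.univ.filter (fun w => G.Adj x w))).card := by
            apply Finset.card_le_card
            intro y hy
            simp only [Finset.mem_filter, Finset.mem_univ, true_and] at hy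
            have := hnomv y hy a haA
            unfold Mv at this
            push Not at this
            obtain ⟨x, hx1, hx2⟩ := this
            simp only [Finset.mem_biUnion, Finset.mem_filter, Finset.mem_univ, true_and, mem_fib]
            exact ⟨x, hx2, hx1.symm⟩
        _ ≤ ∑ x ∈ fib c a, (Finset.univ.filter (fun w => G.Adj x w)).card :=
            Finset.card_biUnion_le
        _ ≤ ∑ x ∈ fib c a, Aᶜ.card := by
            apply Finset.sum_le_sum
            intro x _
            have := hdeg x
            rw [hA1] at hMq
            simp only [Finset.card_singleton] at hMq
            rw [hA1]
            omega
        _ = _ := by simp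
    rw [hB] at hle
    have := h.ha
    nlinarith
  obtain ⟨U, T, hU, hTne, hUT, hT1, hT2, hT3⟩ := term_struct (Ed G c) a hm1
  have hTA : T ⊆ A := fun W hW => (hA W).2 (hT1 W hW).1
  -- inductive colouring of B - y
  have hg : ∀ y, c y ∉ A → ∃ g : V → C, (∀ v, c v ∉ A → v ≠ y → g v ∉ A) ∧
      (∀ v w, c v ∉ A → v ≠ y → c w ∉ A → w ≠ y → G.Adj v w → g v ≠ g w) ∧
      (∀ k, k ∉ A → (Finset.univ.filter (fun v => (c v ∉ A ∧ v ≠ y) ∧ g v = k)).card = s) := by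
    intro y hy
    have hAp : 0 < A.card := Finset.card_pos.2 ⟨a, haA⟩
    have hd1 : ∀ v ∈ Finset.univ.filter (fun v => c v ∉ A ∧ v ≠ y),
        ((Finset.univ.filter (fun v => c v ∉ A ∧ v ≠ y)).filter (fun w => G.Adj v w)).card <
          Aᶜ.card := by
      intro v hv
      simp only [Finset.mem_filter, Finset.mem_univ, true_and] at hv
      refine lt_of_le_of_lt ?_ (hdB v hv.1)
      unfold dg
      apply Finset.card_le_card
      intro w hw
      simp only [Finset.mem_filter, Finset.mem_univ, true_and] at hw
      simp [hw.2, hw.1.1]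
    have hd2 : (Finset.univ.filter (fun v => c v ∉ A ∧ v ≠ y)).card = s * Aᶜ.card := by
      have : (Finset.univ.filter (fun v => c v ∉ A ∧ v ≠ y)) =
          (Finset.univ.filter (fun v => c v ∉ A)).erase y := by
        ext v; simp [and_comm]
      rw [this, Finset.card_erase_of_mem (by simpa using hy), hB, Nat.add_sub_cancel, mul_comm]
    obtain ⟨g, g1, g2, g3⟩ := IH _ Aᶜ (by omega) hd1 hd2
    · refine ⟨g, ?_, ?_, ?_⟩
      · intro v hv hvy
        simpa using g1 v (by simp [hv, hvy])
      · intro v w hv hvy hw hwy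
        exact g2 v (by simp [hv, hvy]) w (by simp [hw, hwy])
      · intro k hk
        have := g3 k (by simpa using hk)
        rwa [Finset.filter_filter] at this
  by_cases hc1 : ∃ z y X, c z ∈ T ∧ c y ∉ A ∧ G.Adj z y ∧ nb G c y (c z) = 1 ∧ X ∈ A ∧ X ≠ c z ∧
      Mv G c z X
  · obtain ⟨z, y, X, hz, hy, hadj, hnb, hXA, hXz, hm⟩ := hc1
    obtain ⟨g, g1, g2, g3⟩ := hg y hy
    exact Or.inl (case1 h A hA hb z y X (hT1 _ hz).2 (hTA hz) hy hadj hnb hm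
      (hT2 _ hz X ((hA X).1 hXA) hXz) g g1 g2 g3)
  · right
    push Not at hc1
    have hzq : ∀ z y, c z ∈ T → c y ∉ A → G.Adj z y → nb G c y (c z) = 1 →
        dg G c z Aᶜ ≤ Aᶜ.card := by
      intro z y hz hy hadj hnb
      have := lower A (A.erase (c z)) (Finset.erase_subset _ _) z (hdeg z) (by
        intro k hk
        obtain ⟨k1, k2⟩ := Finset.mem_erase.1 hk
        exact hc1 z y k hz hy hadj hnb k2 k1)
      rw [Finset.card_erase_of_mem (hTA hz)] at this
      omega
    have hqt : Aᶜ.card < T.card := by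
      obtain ⟨W, hW⟩ := hTne
      apply lemma2 (G := G) (c := c) A W s _ _ (hAs W (hTA hW) (hT1 W hW).2) hB
      · intro y hy; exact nb_pos (hnomv y hy W (hTA hW))
      · rintro z rfl ⟨y, h1, h2, h3⟩; exact hzq z y hW h1 h2 h3
      · rintro z rfl
        have hU' : U ∈ A \ T := Finset.mem_sdiff.2 ⟨(hA U).2 hU, hUT⟩
        have := lower A ((A \ T).erase U)
          ((Finset.erase_subset _ _).trans Finset.sdiff_subset) z (hdeg z) (by
          intro k hk hm
          obtain ⟨k1, k2⟩ := Finset.mem_erase.1 hk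
          obtain ⟨k3, k4⟩ := Finset.mem_sdiff.1 k2
          exact hT3 _ hW k ((hA k).1 k3) k1 k4 ⟨z, rfl, hm⟩)
        rw [Finset.card_erase_of_mem hU', Finset.card_sdiff_of_subset hTA] at this
        have := Finset.card_le_card hTA
        omega
    obtain ⟨z, y, y₂, hz, hy, hy₂, hne, hna, hadj, hadj₂, hnb, hnb₂⟩ :=
      indep (G := G) (c := c) A T s Aᶜ.card hB (by
        rw [card_fibs, Finset.sum_congr rfl (g := fun _ => s)]
        · simp
        · intro k hk; exact hAs k (hTA hk) (hT1 k hk).2) hdB hqt.le (by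
        intro y hy
        have := sigma_bound A T hTA y (hdeg y) (hnomv y hy)
        omega)
    obtain ⟨g, g1, g2, g3⟩ := hg y hy
    have hX : ∃ X, X ∉ A ∧ ∀ v, c v ∉ A → v ≠ y → G.Adj z v → g v ≠ X := by
      by_contra hn
      push Not at hn
      have hsub : Aᶜ ⊆ ((Finset.univ.filter (fun w => G.Adj z w ∧ c w ∈ Aᶜ)).erase y).image g := by
        intro X hX
        obtain ⟨v, v1, v2, v3, v4⟩ := hn X (by simpa using hX)
        refine Finset.mem_image.2 ⟨v, ?_, v4⟩
        simp [v1, v2, v3]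
      have h1 := (Finset.card_le_card hsub).trans Finset.card_image_le
      have hyy : y ∈ Finset.univ.filter (fun w => G.Adj z w ∧ c w ∈ Aᶜ) := by simp [hadj, hy]
      have h2 := Finset.card_erase_add_one hyy
      have h3 := hzq z y hz hy hadj hnb
      unfold dg at h3
      omega
    obtain ⟨X, hXA, hX⟩ := hX
    obtain ⟨f, f1, f2, f3⟩ := case2 h A hA hb z y y₂ X (hT1 _ hz).2 (hTA hz) hy hadj hnb hy₂ hadj₂
      hnb₂ hne hna (fun k hk hkz => hc1 z y k hz hy hadj hnb hk hkz)
      (fun k hk hkz => hT2 _ hz k ((hA k).1 hk) hkz) g g1 g2 g3 hXA hX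
    exact ⟨f, X, f1, f2, f3⟩

theorem near_equi {V : Type u} {C : Type v} [Fintype V] [Fintype C] {G : SimpleGraph V}
    {s : ℕ} (hdeg : ∀ v, (Finset.univ.filter (fun w => G.Adj v w)).card < Fintype.card C)
    (IH : FinIH V C G s) (n : ℕ) : ∀ (c : V → C) (a b : C), Near G s c a b →
    (Finset.univ.filter (fun k => ¬ Reach (Ed G c) a Finset.univ k)).card ≤ n → Equi C G s := by
  induction n with
  | zero =>
    intro c a b h hn
    apply near_acc h
    by_contra hb
    have : 0 < (Finset.univ.filter (fun k => ¬ Reach (Ed G c) a Finset.univ k)).card :=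
      Finset.card_pos.2 ⟨b, by simpa using hb⟩
    omega
  | succ n ih =>
    intro c a b h hn
    rcases near_step hdeg IH h (Finset.univ.filter (fun k => Reach (Ed G c) a Finset.univ k))
      (by simp) with h1 | ⟨f, X, f1, f2, k, k1, k2⟩
    · exact h1
    · apply ih f a X f1
      have : (Finset.univ.filter (fun k => ¬ Reach (Ed G f) a Finset.univ k)) ⊂
          (Finset.univ.filter (fun k => ¬ Reach (Ed G c) a Finset.univ k)) := by
        refine (Finset.ssubset_iff_of_subset ?_).2 ⟨k, ?_, ?_⟩
        · intro j hj
          simp only [Finset.mem_filter, Finset.mem_univ, true_and] at hj f2 ⊢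
          exact fun h => hj (f2 j h)
        · simpa using k1
        · simpa using k2
      have := Finset.card_lt_card this
      omega

/-- `G` restricted to edges inside `T`. -/
def restr {V : Type u} (G : SimpleGraph V) (T : Finset V) : SimpleGraph V where
  Adj x y := G.Adj x y ∧ x ∈ T ∧ y ∈ T
  symm := ⟨fun _ _ h => ⟨h.1.symm, h.2.2, h.2.1⟩⟩
  loopless := ⟨fun _ h => G.loopless.irrefl _ h.1⟩

theorem hs_main (n : ℕ) : ∀ (V : Type u) (C : Type v) [Fintype V] [Fintype C] (G : SimpleGraph V)
    (s : ℕ), Fintype.card C = n →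
    (∀ v, (Finset.univ.filter (fun w => G.Adj v w)).card < Fintype.card C) →
    Fintype.card V = s * Fintype.card C → Equi C G s := by
  induction n using Nat.strong_induction_on with
  | _ n ih =>
  intro V C _ _ G s hn hdeg hcard
  have hIH : ∀ H : SimpleGraph V, FinIH V C H s := by
    intro H B K hK hBdeg hBc
    obtain ⟨f, f1, f2⟩ := ih K.card (hn ▸ hK) {v // v ∈ B} {k // k ∈ K}
      (H.comap (fun v => v.1)) s (by simp) (by
        intro v
        have := hBdeg v.1 v.2
        rw [Fintype.card_coe]
        refine lt_of_le_of_lt ?_ this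
        rw [← Finset.card_map (Function.Embedding.subtype _)]
        apply Finset.card_le_card
        intro w hw
        simp only [Finset.mem_map, Finset.mem_filter, Finset.mem_univ, true_and,
          Function.Embedding.subtype_apply, SimpleGraph.comap_adj] at hw
        obtain ⟨x, hx, rfl⟩ := hw
        exact Finset.mem_filter.2 ⟨x.2, hx⟩) (by simpa using hBc)
    by_cases hC : Nonempty C
    · obtain ⟨k0⟩ := hC
      refine ⟨fun v => if hv : v ∈ B then (f ⟨v, hv⟩).1 else k0, ?_, ?_, ?_⟩
      · intro v hv; simp [hv]
      · intro v hv w hw hvw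
        simp only [hv, hw, dif_pos]
        intro e
        exact f1 ⟨v, hv⟩ ⟨w, hw⟩ hvw (Subtype.ext e)
      · intro k hk
        rw [← f2 ⟨k, hk⟩, ← Finset.card_map (Function.Embedding.subtype _)]
        congr 1
        ext v
        simp only [Finset.mem_filter, Finset.mem_map, mem_fib, Function.Embedding.subtype_apply]
        constructor
        · rintro ⟨hv, e⟩
          simp only [hv, dif_pos] at e
          exact ⟨⟨v, hv⟩, Subtype.ext e, rfl⟩
        · rintro ⟨x, hx, rfl⟩
          refine ⟨x.2, ?_⟩
          simp [hx]
    · exfalso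
      have := not_nonempty_iff.1 hC
      simp at hK
  have key : ∀ T : Finset V, Equi C (restr G T) s := by
    intro T
    induction T using Finset.induction_on with
    | empty =>
      have e : V ≃ C × Fin s := Fintype.equivOfCardEq (by simp [hcard, mul_comm])
      refine ⟨fun v => (e v).1, ?_, ?_⟩
      · intro x y h; exact absurd h.2.1 (by simp)
      · intro k
        have : fib (fun v => (e v).1) k =
            (Finset.univ : Finset (Fin s)).image (fun i => e.symm (k, i)) := by
          ext v
          simp only [mem_fib, Finset.mem_image, Finset.mem_univ, true_and]
          constructor
          · rintro rfl; exact ⟨(e v).2, by simp⟩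
          · rintro ⟨i, rfl⟩; simp
        rw [this, Finset.card_image_of_injective]
        · simp
        · intro i j hij
          simpa using hij
    | insert u T hu ihT =>
      obtain ⟨c, c1, c2⟩ := ihT
      have hk : ∃ k, ∀ v, G.Adj u v → c v ≠ k := by
        by_contra hno
        push Not at hno
        have : (Finset.univ : Finset C) ⊆ (Finset.univ.filter (fun w => G.Adj u w)).image c := by
          intro k _
          obtain ⟨v, v1, v2⟩ := hno k
          exact Finset.mem_image.2 ⟨v, by simpa using v1, v2⟩
        have h1 := (Finset.card_le_card this).trans Finset.card_image_le
        have h2 := hdeg u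
        rw [Finset.card_univ] at h1
        omega
      obtain ⟨k, hk⟩ := hk
      have hprop : Proper (restr G (insert u T)) (Function.update c u k) := by
        intro p q hpq
        obtain ⟨h1, h2, h3⟩ := hpq
        by_cases hp : p = u
        · subst hp
          rw [Function.update_self, Function.update_of_ne h1.ne']
          exact (hk q h1).symm
        · by_cases hq : q = u
          · subst hq
            rw [Function.update_self, Function.update_of_ne h1.ne]
            exact hk p h1.symm
          · rw [Function.update_of_ne hp, Function.update_of_ne hq]
            exact c1 p q ⟨h1, Finset.mem_of_mem_insert_of_ne h2 hp,
              Finset.mem_of_mem_insert_of_ne h3 hq⟩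
      by_cases hcu : c u = k
      · refine ⟨c, ?_, c2⟩
        rwa [← hcu, Function.update_eq_self] at hprop
      · apply near_equi (G := restr G (insert u T)) _ (hIH _) _ (Function.update c u k) (c u) k
          ⟨hprop, hcu, ?_, ?_, ?_⟩ le_rfl
        · intro v
          refine lt_of_le_of_lt (Finset.card_le_card ?_) (hdeg v)
          intro w hw
          simp only [Finset.mem_filter, Finset.mem_univ, true_and] at hw ⊢
          exact hw.1
        · have : fib (Function.update c u k) (c u) = (fib c (c u)).erase u := by
            ext v
            by_cases hv : v = u
            · subst hv; simp [mem_fib, Ne.symm hcu]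
            · simp [mem_fib, hv]
          rw [this, Finset.card_erase_add_one (mem_fib.2 rfl), c2]
        · have : fib (Function.update c u k) k = insert u (fib c k) := by
            ext v
            by_cases hv : v = u
            · subst hv; simp [mem_fib]
            · simp [mem_fib, hv]
          rw [this, Finset.card_insert_of_notMem (by rw [mem_fib]; exact hcu), c2]
        · intro j j1 j2
          have : fib (Function.update c u k) j = fib c j := by
            ext v
            by_cases hv : v = u
            · subst hv; simp [mem_fib, Ne.symm j1, Ne.symm j2]
            · simp [mem_fib, hv]
          rw [this, c2]
  obtain ⟨c, c1, c2⟩ := key Finset.univ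
  exact ⟨c, fun p q h => c1 p q ⟨h, by simp, by simp⟩, c2⟩

theorem final {V : Type u} [Fintype V] (G : SimpleGraph V) (d : ℕ)
    (hdeg : ∀ v, (Finset.univ.filter (fun w => G.Adj v w)).card ≤ d) :
    ∃ c : V → Fin (d + 1), Proper G c ∧ ∃ s, ∀ i, (fib c i).card ≤ s ∧ s ≤ (fib c i).card + 1 := by
  obtain ⟨s, p, hp, hs⟩ : ∃ s p, p ≤ d ∧ Fintype.card V + p = s * (d + 1) := by
    have h1 := Nat.div_add_mod (Fintype.card V + d) (d + 1)
    have h2 := Nat.mod_lt (Fintype.card V + d) (Nat.succ_pos d)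
    refine ⟨(Fintype.card V + d) / (d + 1), d - (Fintype.card V + d) % (d + 1), by omega, ?_⟩
    rw [mul_comm]
    simp only [Nat.succ_eq_add_one] at h2
    omega
  obtain ⟨f, f1, f2⟩ := hs_main (d + 1) (V ⊕ Fin p) (Fin (d + 1))
    (G ⊕g (⊤ : SimpleGraph (Fin p))) s (by simp) (by
      rintro (v | i)
      · rw [Fintype.card_fin]
        refine Nat.lt_succ_of_le (le_trans ?_ (hdeg v))
        rw [← Finset.card_map Function.Embedding.inl (s := Finset.univ.filter (fun w => G.Adj v w))]
        apply Finset.card_le_card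
        rintro (w | j) hw
        · simpa using hw
        · simp at hw
      · rw [Fintype.card_fin]
        refine Nat.lt_succ_of_le (le_trans ?_ hp)
        calc _ ≤ ((Finset.univ : Finset (Fin p)).map
              (Function.Embedding.inr : Fin p ↪ V ⊕ Fin p)).card := by
              apply Finset.card_le_card
              rintro (w | j) hw
              · simp at hw
              · simp
          _ = p := by simp) (by simpa using hs)
  refine ⟨fun v => f (Sum.inl v), ?_, s, ?_⟩
  · intro x y h
    exact f1 _ _ (by simpa using h)
  · intro i
    have h1 : (fib f i).card = (fib (fun v => f (Sum.inl v)) i).card +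
        (fib (fun j => f (Sum.inr j)) i).card := by
      rw [← Finset.card_disjSum]
      congr 1
      ext x
      rcases x with x | x <;> simp [mem_fib]
    have h2 : (fib (fun j => f (Sum.inr j)) i).card ≤ 1 := by
      rw [Finset.card_le_one]
      intro x hx y hy
      rw [mem_fib] at hx hy
      by_contra hne
      exact f1 (Sum.inr x) (Sum.inr y) (by simpa using hne) (hx.trans hy.symm)
    have h3 := f2 i
    omega

end HSz

/-- Hajnal–Szemerédi theorem (equitable coloring): every finite simple graph of
maximum degree at most `d` has a proper coloring with `d+1` colors in which the
sizes of any two color classes differ by at most 1. -/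
theorem equitable_coloring_exists
    {V : Type*} [Fintype V] [DecidableEq V] (G : SimpleGraph V)
    [DecidableRel G.Adj] (d : ℕ) (hdeg : ∀ v, G.degree v ≤ d) :
    ∃ c : V → Fin (d + 1),
      (∀ u v, G.Adj u v → c u ≠ c v) ∧
      (∀ i j : Fin (d + 1),
        (Finset.univ.filter (fun v => c v = i)).card ≤
          (Finset.univ.filter (fun v => c v = j)).card + 1) := by
  obtain ⟨c, h1, s, h2⟩ := HSz.final G d (by
    intro v
    refine le_trans (le_of_eq ?_) (hdeg v)
    rw [← SimpleGraph.card_neighborFinset_eq_degree]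
    congr 1
    ext w
    simp)
  refine ⟨c, h1, fun i j => ?_⟩
  have hf : ∀ k, (Finset.univ.filter (fun v => c v = k)).card = (HSz.fib c k).card := by
    intro k
    congr 1
    ext v
    simp [HSz.mem_fib]
  rw [hf, hf]
  have := h2 i
  have := h2 j
  omega
end
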